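/- Let R be a commutative ring having Property (A) and let B be a content R-algebra. Suppose Z(R) = p₁ ∪ … ∪ pₙ where the pᵢ are prime ideals of R such that pᵢ is not contained in the union of the pⱼ with j ≠ i, for each i. Then Z(B) = p₁B ∪ … ∪ pₙB, each pᵢB is a prime ideal of B, and pᵢB ⊆ pⱼB if and only if pᵢ ⊆ pⱼ; consequently zd(B) = n. -/

import Mathlib

/-- The content `c(f)` of an element `f` of a commutative `R`-algebra `B`: the
intersection of all ideals `I` of `R` with `f ∈ IB`. -/
def contentIdeal (R : Type*) {B : Type*} [CommRing R] [CommRing B] [Algebra R B]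
    (f : B) : Ideal R :=
  sInf {I : Ideal R | f ∈ I • (⊤ : Submodule R B)}

/-- `B` is a content `R`-algebra: (i) `f ∈ c(f)B` for all `f`; (ii) `c(rf) = r·c(f)`
and the ideal generated by all the contents is `R`; (iii) the Dedekind–Mertens content
formula holds. -/
structure IsContentAlgebra (R B : Type*) [CommRing R] [CommRing B] [Algebra R B] : Prop where
  mem_content_smul : ∀ f : B, f ∈ contentIdeal R f • (⊤ : Submodule R B)
  content_smul : ∀ (r : R) (f : B),
    contentIdeal R (algebraMap R B r * f) = Ideal.span {r} * contentIdeal R f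
  content_top : (⨆ f : B, contentIdeal R f) = ⊤
  dedekind_mertens : ∀ f g : B, ∃ n : ℕ, 1 ≤ n ∧
    contentIdeal R f ^ n * contentIdeal R g =
      contentIdeal R f ^ (n - 1) * contentIdeal R (f * g)

/-- The set of zero-divisors of `R`. -/
def zdSet (R : Type*) [CommRing R] : Set R := {r : R | ∃ s : R, s ≠ 0 ∧ r * s = 0}

/-- `R` has Property (A): every finitely generated ideal consisting of zero-divisors has
a nonzero annihilator. -/
def PropertyA (R : Type*) [CommRing R] : Prop :=
  ∀ I : Ideal R, I.FG → (I : Set R) ⊆ zdSet R → ∃ r : R, r ≠ 0 ∧ ∀ x ∈ I, r * x = 0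

/-- `Z(R)` is a union of `n` prime ideals of `R`. -/
def ZdUnion (R : Type*) [CommRing R] (n : ℕ) : Prop :=
  ∃ p : Fin n → Ideal R, (∀ i, (p i).IsPrime) ∧ zdSet R = ⋃ i, (p i : Set R)

/-- `zd(R) = n`: `Z(R)` is a union of `n` prime ideals of `R`, but not a union of fewer
than `n` prime ideals of `R`. -/
def ZdEq (R : Type*) [CommRing R] (n : ℕ) : Prop :=
  ZdUnion R n ∧ ∀ m : ℕ, m < n → ¬ ZdUnion R m

section ContentAlgebra

variable {R B : Type*} [CommRing R] [CommRing B] [Algebra R B]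

theorem contentIdeal_le {f : B} {I : Ideal R} (h : f ∈ I.map (algebraMap R B)) :
    contentIdeal R f ≤ I := by
  refine sInf_le ?_
  rw [Set.mem_ofPred_eq, Ideal.smul_top_eq_map]
  exact h

theorem exists_fg_le_mem_smul_top {f : B} {I : Ideal R} (h : f ∈ I • (⊤ : Submodule R B)) :
    ∃ J : Ideal R, J.FG ∧ J ≤ I ∧ f ∈ J • (⊤ : Submodule R B) := by
  induction h using Submodule.smul_induction_on' with
  | smul r hr b hb =>
    exact ⟨Ideal.span {r}, Submodule.fg_span_singleton r, (Ideal.span_singleton_le_iff_mem _).2 hr,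
      Submodule.smul_mem_smul (Ideal.mem_span_singleton_self r) hb⟩
  | add x hx y hy ihx ihy =>
    obtain ⟨J, hJ, hJI, hxJ⟩ := ihx
    obtain ⟨K, hK, hKI, hyK⟩ := ihy
    exact ⟨J ⊔ K, Submodule.FG.sup hJ hK, sup_le hJI hKI, add_mem
      (Submodule.smul_mono_left le_sup_left hxJ) (Submodule.smul_mono_left le_sup_right hyK)⟩

namespace IsContentAlgebra

theorem mem_map_iff (hB : IsContentAlgebra R B) {f : B} {I : Ideal R} :
    f ∈ I.map (algebraMap R B) ↔ contentIdeal R f ≤ I := by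
  refine ⟨contentIdeal_le, fun h => ?_⟩
  have := Submodule.smul_mono_left h (hB.mem_content_smul f)
  rwa [Ideal.smul_top_eq_map] at this

theorem fg_content (hB : IsContentAlgebra R B) (f : B) : (contentIdeal R f).FG := by
  obtain ⟨J, hJ, hle, hf⟩ := exists_fg_le_mem_smul_top (hB.mem_content_smul f)
  have heq : contentIdeal R f = J := le_antisymm (sInf_le hf) hle
  rwa [heq]

theorem content_eq_bot_iff (hB : IsContentAlgebra R B) {f : B} :
    contentIdeal R f = ⊥ ↔ f = 0 := by
  rw [← le_bot_iff, ← hB.mem_map_iff, Ideal.map_bot, Ideal.mem_bot]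

theorem content_one (hB : IsContentAlgebra R B) : contentIdeal R (1 : B) = ⊤ := by
  rw [← top_le_iff, ← hB.content_top]
  refine iSup_le fun f => contentIdeal_le ?_
  rw [(Ideal.eq_top_iff_one _).2 (hB.mem_map_iff.2 le_rfl)]
  exact Submodule.mem_top

theorem content_algebraMap (hB : IsContentAlgebra R B) (r : R) :
    contentIdeal R (algebraMap R B r) = Ideal.span {r} := by
  have := hB.content_smul r 1
  rwa [mul_one, hB.content_one, Ideal.mul_top] at this

theorem algebraMap_mem_map_iff (hB : IsContentAlgebra R B) {r : R} {I : Ideal R} :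
    algebraMap R B r ∈ I.map (algebraMap R B) ↔ r ∈ I := by
  rw [hB.mem_map_iff, hB.content_algebraMap, Ideal.span_singleton_le_iff_mem]

theorem map_le_map_iff (hB : IsContentAlgebra R B) {I J : Ideal R} :
    I.map (algebraMap R B) ≤ J.map (algebraMap R B) ↔ I ≤ J :=
  ⟨fun h _ hr => hB.algebraMap_mem_map_iff.1 (h (Ideal.mem_map_of_mem _ hr)),
    fun h => Ideal.map_mono h⟩

theorem isPrime_map (hB : IsContentAlgebra R B) {p : Ideal R} (hp : p.IsPrime) :
    (p.map (algebraMap R B)).IsPrime := by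
  refine ⟨fun h => hp.ne_top ?_, fun {f g} hfg => ?_⟩
  · rw [Ideal.eq_top_iff_one, hB.mem_map_iff, hB.content_one] at h
    exact top_le_iff.1 h
  · rw [hB.mem_map_iff] at hfg ⊢
    rw [hB.mem_map_iff]
    obtain ⟨n, -, hn⟩ := hB.dedekind_mertens f g
    have hle : contentIdeal R f ^ n * contentIdeal R g ≤ p :=
      hn.trans_le (Ideal.mul_le_right.trans hfg)
    exact (hp.mul_le.1 hle).imp_left hp.le_of_pow_le

/-- The content of a zero-divisor consists of zero-divisors. -/
theorem content_subset_zdSet (hB : IsContentAlgebra R B) {f : B} (hf : f ∈ zdSet B) :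
    (contentIdeal R f : Set R) ⊆ zdSet R := by
  obtain ⟨g, hg, hfg⟩ := hf
  obtain ⟨n, -, hn⟩ := hB.dedekind_mertens f g
  rw [hfg, hB.content_eq_bot_iff.2 rfl, Ideal.mul_bot] at hn
  rw [Ne, ← hB.content_eq_bot_iff (R := R)] at hg
  obtain ⟨s, hs, hs0⟩ := Submodule.exists_mem_ne_zero_of_ne_bot hg
  intro r hr
  by_contra hreg
  have hr0 : ∀ s : R, r * s = 0 → s = 0 := fun s h => by
    by_contra hs
    exact hreg ⟨s, hs, h⟩
  have hpow : ∀ k : ℕ, r ^ k * s = 0 → s = 0 := fun k => by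
    induction k with
    | zero => simp
    | succ k ih => exact fun h => ih (hr0 _ (by rw [← h]; ring))
  refine hs0 (hpow n ?_)
  rw [← Ideal.mem_bot, ← hn]
  exact Ideal.mul_mem_mul (Ideal.pow_mem_pow hr n) hs

/-- Over a ring with Property (A), an element is a zero-divisor exactly when its content consists of
zero-divisors. -/
theorem mem_zdSet_iff (hB : IsContentAlgebra R B) (hA : PropertyA R) {f : B} :
    f ∈ zdSet B ↔ (contentIdeal R f : Set R) ⊆ zdSet R := by
  refine ⟨hB.content_subset_zdSet, fun h => ?_⟩
  obtain ⟨r, hr, hrf⟩ := hA _ (hB.fg_content f) h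
  refine ⟨algebraMap R B r, fun h0 => hr ?_, ?_⟩
  · rwa [← hB.content_eq_bot_iff (R := R), hB.content_algebraMap,
      Ideal.span_singleton_eq_bot] at h0
  · rw [mul_comm, ← hB.content_eq_bot_iff (R := R), hB.content_smul, ← le_bot_iff,
      Ideal.span_singleton_mul_le_iff]
    exact fun x hx => Ideal.mem_bot.2 (hrf x hx)

end IsContentAlgebra

end ContentAlgebra

/-- Prime avoidance for a finite family of prime ideals. -/
theorem Ideal.exists_le_of_subset_iUnion_prime {R ι : Type*} [CommRing R] [Finite ι]
    {p : ι → Ideal R} (hp : ∀ i, (p i).IsPrime) {I : Ideal R}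
    (h : (I : Set R) ⊆ ⋃ i, (p i : Set R)) : ∃ i, I ≤ p i := by
  cases nonempty_fintype ι
  obtain ⟨x, hx⟩ := Set.mem_iUnion.1 (h I.zero_mem)
  have := (Ideal.subset_union_prime (s := Finset.univ) x x (fun i _ _ _ => hp i) (I := I)).1
    (by simpa using h)
  simpa using this

/-- A finite union of pairwise incomparable prime ideals is not a union of fewer prime ideals. -/
theorem le_of_iUnion_prime_eq {R : Type*} [CommRing R] {m n : ℕ} {p : Fin n → Ideal R}
    {q : Fin m → Ideal R} (hp : ∀ i, (p i).IsPrime) (hq : ∀ j, (q j).IsPrime)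
    (hinc : ∀ i j, p i ≤ p j → i = j)
    (h : ⋃ i, (p i : Set R) = ⋃ j, (q j : Set R)) : n ≤ m := by
  have hpq : ∀ i, ∃ j, p i ≤ q j := fun i =>
    Ideal.exists_le_of_subset_iUnion_prime hq
      (h ▸ Set.subset_iUnion (fun i => (p i : Set R)) i)
  have hqp : ∀ j, ∃ i, q j ≤ p i := fun j =>
    Ideal.exists_le_of_subset_iUnion_prime hp
      (h ▸ Set.subset_iUnion (fun j => (q j : Set R)) j)
  choose σ hσ using hpq
  choose τ hτ using hqp
  have hleft : Function.LeftInverse τ σ := fun i => (hinc i _ ((hσ i).trans (hτ (σ i)))).symm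
  simpa using Fintype.card_le_of_injective σ hleft.injective

/-- Let `R` have Property (A) and `B` be a content `R`-algebra. If
`Z(R) = p₁ ∪ … ∪ pₙ` with each `pᵢ` prime and no `pᵢ` contained in the union of the
others, then `Z(B) = p₁B ∪ … ∪ pₙB`, each `pᵢB` is prime, `pᵢB ⊆ pⱼB ↔ pᵢ ⊆ pⱼ`, and
consequently `zd(B) = n`. -/
theorem zd_eq_of_propertyA_isContentAlgebra
    (R B : Type*) [CommRing R] [CommRing B] [Algebra R B]
    (hA : PropertyA R) (hB : IsContentAlgebra R B)
    (n : ℕ) (hn : 1 ≤ n) (p : Fin n → Ideal R) (hprime : ∀ i, (p i).IsPrime)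
    (hZ : zdSet R = ⋃ i, (p i : Set R))
    (hirr : ∀ i, ¬ ((p i : Set R) ⊆ ⋃ j ∈ ({i}ᶜ : Set (Fin n)), (p j : Set R))) :
    zdSet B = (⋃ i, ((p i).map (algebraMap R B) : Set B)) ∧
    (∀ i, ((p i).map (algebraMap R B)).IsPrime) ∧
    (∀ i j, (p i).map (algebraMap R B) ≤ (p j).map (algebraMap R B) ↔ p i ≤ p j) ∧
    ZdEq B n := by
  have hprimeB : ∀ i, ((p i).map (algebraMap R B)).IsPrime := fun i => hB.isPrime_map (hprime i)
  have hZB : zdSet B = ⋃ i, ((p i).map (algebraMap R B) : Set B) := by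
    ext f
    simp only [hB.mem_zdSet_iff hA, hZ, Set.mem_iUnion, SetLike.mem_coe, hB.mem_map_iff]
    exact ⟨Ideal.exists_le_of_subset_iUnion_prime hprime,
      fun ⟨i, hi⟩ x hx => Set.mem_iUnion.2 ⟨i, hi hx⟩⟩
  have hinc : ∀ i j, p i ≤ p j → i = j := fun i j hij => by
    by_contra hne
    exact hirr i fun x hx => Set.mem_biUnion (Ne.symm hne : j ∈ ({i}ᶜ : Set (Fin n))) (hij hx)
  refine ⟨hZB, hprimeB, fun i j => hB.map_le_map_iff, ⟨_, hprimeB, hZB⟩, ?_⟩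
  rintro m hm ⟨q, hq, hZq⟩
  exact hm.not_ge (le_of_iUnion_prime_eq hprimeB hq
    (fun i j hij => hinc i j (hB.map_le_map_iff.1 hij)) (hZB.symm.trans hZq))
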